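/- Fix n, k ≥ 1 and let V_ns be the universal nonsignalling vector space with generators Q(a,b|x,y), unit e_ns, and cone D_ns; let N := n²k², fix an enumeration p_1, …, p_N of the generators, and let D_qc := C^max(p_1, …, p_N)^∞_1 ⊆ V_ns. Then: (a) D_qc is a proper cone, i.e., D_qc ∩ −D_qc = {0} (so that (V_ns, D_qc, e_ns) is an AOU space); and (b) D_qc is independent of the chosen enumeration: for any other enumeration q_1, …, q_N of the generators and every m ≥ 1, C^max(p_1, …, p_N)^∞_m = C^max(q_1, …, q_N)^∞_m. -/

import Mathlib

open scoped ComplexOrder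

/-- `x` is a hermitian matrix over a ∗-vector space. -/
def IsHermMat {V ι : Type} [Star V] (x : Matrix ι ι V) : Prop :=
  ∀ i j, x j i = star (x i j)

/-- A family of cones of matrices over `V`, one for each finite matrix-index type. -/
abbrev ConeFamily (V : Type) : Type 1 :=
  ∀ (ι : Type) [Fintype ι] [DecidableEq ι], Set (Matrix ι ι V)

section Core

variable {V : Type} [AddCommGroup V] [Module ℂ V] [StarAddMonoid V] [StarModule ℂ V]

/-- conjugation `α* x α` of `x ∈ M_ι(V)` by a scalar matrix `α : M_{ι,κ}(ℂ)`. -/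
def conjBy {ι κ : Type} [Fintype ι] (α : Matrix ι κ ℂ) (x : Matrix ι ι V) :
    Matrix κ κ V :=
  Matrix.of fun s t => ∑ i, ∑ j, ((starRingEnd ℂ) (α i s) * α j t) • x i j

/-- `C` is a matrix ordering on the ∗-vector space `V`. -/
structure IsMatrixOrdering (C : ConeFamily V) : Prop where
  herm_mem : ∀ (ι : Type) [Fintype ι] [DecidableEq ι], ∀ x ∈ C ι, IsHermMat x
  add_mem : ∀ (ι : Type) [Fintype ι] [DecidableEq ι], ∀ x ∈ C ι, ∀ y ∈ C ι, x + y ∈ C ι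
  smul_mem : ∀ (ι : Type) [Fintype ι] [DecidableEq ι], ∀ r : ℝ, 0 ≤ r → ∀ x ∈ C ι,
    (r : ℂ) • x ∈ C ι
  conj_mem : ∀ (ι κ : Type) [Fintype ι] [DecidableEq ι] [Fintype κ] [DecidableEq κ],
    ∀ (α : Matrix ι κ ℂ), ∀ x ∈ C ι, conjBy α x ∈ C κ

/-- the diagonal matrix `I_ι ⊗ e` with `e` in every diagonal entry. -/
def unitMat {ι : Type} [DecidableEq ι] (e : V) : Matrix ι ι V :=
  Matrix.of fun i j => if i = j then e else 0

/-- membership of an element of `V` in the ground-level cone `C_1`. -/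
def Mem1 (C : ConeFamily V) (v : V) : Prop :=
  (Matrix.of fun _ _ => v : Matrix (Fin 1) (Fin 1) V) ∈ C (Fin 1)

/-- `(V, C, e)` is an (abstract) operator system: `C` is a proper matrix ordering and
`e` is an Archimedean matrix order unit. -/
structure IsOperatorSystem (C : ConeFamily V) (e : V) extends IsMatrixOrdering C : Prop where
  proper : ∀ (ι : Type) [Fintype ι] [DecidableEq ι], ∀ x ∈ C ι, -x ∈ C ι → x = 0
  unit_mem : Mem1 C e
  orderUnit : ∀ (ι : Type) [Fintype ι] [DecidableEq ι], ∀ x : Matrix ι ι V, IsHermMat x →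
    ∃ t : ℝ, 0 < t ∧ (t : ℂ) • (unitMat e : Matrix ι ι V) - x ∈ C ι
  arch : ∀ (ι : Type) [Fintype ι] [DecidableEq ι], ∀ x : Matrix ι ι V,
    (∀ ε : ℝ, 0 < ε → x + (ε : ℂ) • (unitMat e : Matrix ι ι V) ∈ C ι) → x ∈ C ι

/-- `p` is a positive contraction: `p ∈ C_1` and `e - p ∈ C_1`. -/
def IsPosCon (C : ConeFamily V) (e p : V) : Prop :=
  Mem1 C p ∧ Mem1 C (e - p)

/-- the `2 × 2` diagonal matrix `p ⊕ q` over `V`. -/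
def diagPQ (p q : V) : Matrix (Fin 2) (Fin 2) V :=
  Matrix.of fun s t => if s = t then (if s = 0 then p else q) else 0

/-- `I_ι ⊗ y`. -/
def idKron {ι κ : Type} [DecidableEq ι] (y : Matrix κ κ V) : Matrix (ι × κ) (ι × κ) V :=
  Matrix.of fun a b => if a.1 = b.1 then y a.2 b.2 else 0

/-- `x ⊗ J_κ`, the Kronecker product of `x` with the all-ones matrix. -/
def onesKron {ι κ : Type} (x : Matrix ι ι V) : Matrix (ι × κ) (ι × κ) V :=
  Matrix.of fun a b => x a.1 b.1

/-- the cone `C(p)_ι ⊆ M_{ι × 2}(V)` associated to a positive contraction `p`. -/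
def coneP (C : ConeFamily V) (e p : V) (ι : Type) [Fintype ι] [DecidableEq ι] :
    Set (Matrix (ι × Fin 2) (ι × Fin 2) V) :=
  {x | IsHermMat x ∧ ∀ ε : ℝ, 0 < ε → ∃ t : ℝ, 0 < t ∧
    x + (ε : ℂ) • idKron (diagPQ p (e - p)) + (t : ℂ) • idKron (diagPQ (e - p) p)
      ∈ C (ι × Fin 2)}

end Core

section Multi

variable {V : Type} [AddCommGroup V] [Module ℂ V] [StarAddMonoid V] [StarModule ℂ V] {N : ℕ}

/-- `P_k^N = I_{2^{k-1}} ⊗ (p_k ⊕ p_k^⊥) ⊗ J_{2^{N-k}}` as a matrix indexed by binary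
strings of length `N` (the `j`-th bit corresponding to the `j`-th tensor factor of `2^N`). -/
def Pm (e : V) (p : Fin N → V) (k : Fin N) :
    Matrix (Fin N → Fin 2) (Fin N → Fin 2) V :=
  Matrix.of fun σ τ =>
    if (∀ j, j < k → σ j = τ j) ∧ σ k = τ k then
      (if σ k = 0 then p k else e - p k) else 0

/-- `Q_k^N = I_{2^{k-1}} ⊗ (p_k^⊥ ⊕ p_k) ⊗ J_{2^{N-k}}`. -/
def Qm (e : V) (p : Fin N → V) (k : Fin N) :
    Matrix (Fin N → Fin 2) (Fin N → Fin 2) V :=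
  Matrix.of fun σ τ =>
    if (∀ j, j < k → σ j = τ j) ∧ σ k = τ k then
      (if σ k = 0 then e - p k else p k) else 0

/-- `P̂_k^N = J_{2^{k-1}} ⊗ (p_k ⊕ p_k^⊥) ⊗ J_{2^{N-k}}`. -/
def PmHat (e : V) (p : Fin N → V) (k : Fin N) :
    Matrix (Fin N → Fin 2) (Fin N → Fin 2) V :=
  Matrix.of fun σ τ =>
    if σ k = τ k then (if σ k = 0 then p k else e - p k) else 0

/-- `Q̂_k^N = J_{2^{k-1}} ⊗ (p_k^⊥ ⊕ p_k) ⊗ J_{2^{N-k}}`. -/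
def QmHat (e : V) (p : Fin N → V) (k : Fin N) :
    Matrix (Fin N → Fin 2) (Fin N → Fin 2) V :=
  Matrix.of fun σ τ =>
    if σ k = τ k then (if σ k = 0 then e - p k else p k) else 0

/-- `x + Σ_k ε_k (I_ι ⊗ P_k^N) + Σ_k t_k (I_ι ⊗ Q_k^N) ∈ C_{ι·2^N}`. -/
def MemMulti (C : ConeFamily V) (e : V) (p : Fin N → V)
    (ι : Type) [Fintype ι] [DecidableEq ι]
    (x : Matrix (ι × (Fin N → Fin 2)) (ι × (Fin N → Fin 2)) V) (ε t : Fin N → ℝ) : Prop :=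
  x + ∑ k, (ε k : ℂ) • idKron (Pm e p k) + ∑ k, (t k : ℂ) • idKron (Qm e p k)
    ∈ C (ι × (Fin N → Fin 2))

/-- the cone `C(p_1, …, p_N)_ι ⊆ M_{ι·2^N}(V)`. -/
def coneMulti (C : ConeFamily V) (e : V) (p : Fin N → V)
    (ι : Type) [Fintype ι] [DecidableEq ι] :
    Set (Matrix (ι × (Fin N → Fin 2)) (ι × (Fin N → Fin 2)) V) :=
  {x | IsHermMat x ∧ ∀ ε : Fin N → ℝ, (∀ i, 0 < ε i) →
    ∃ t : Fin N → ℝ, (∀ i, 0 < t i) ∧ MemMulti C e p ι x ε t ∧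
      ∀ (i : Fin N) (ε' : ℝ), 0 < ε' → ε' < ε i →
        ∃ t' : ℝ, t i < t' ∧
          MemMulti C e p ι x (Function.update ε i ε') (Function.update t i t')}

/-- the `⊗J`-version of `MemMulti`, with `P̂`, `Q̂` in place of `P`, `Q`. -/
def MemMultiHat (C : ConeFamily V) (e : V) (p : Fin N → V)
    (ι : Type) [Fintype ι] [DecidableEq ι]
    (x : Matrix (ι × (Fin N → Fin 2)) (ι × (Fin N → Fin 2)) V) (ε t : Fin N → ℝ) : Prop :=
  x + ∑ k, (ε k : ℂ) • idKron (PmHat e p k) + ∑ k, (t k : ℂ) • idKron (QmHat e p k)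
    ∈ C (ι × (Fin N → Fin 2))

/-- the cone `Ĉ(p_1, …, p_N)_ι ⊆ M_{ι·2^N}(V)`. -/
def coneMultiHat (C : ConeFamily V) (e : V) (p : Fin N → V)
    (ι : Type) [Fintype ι] [DecidableEq ι] :
    Set (Matrix (ι × (Fin N → Fin 2)) (ι × (Fin N → Fin 2)) V) :=
  {x | IsHermMat x ∧ ∀ ε : Fin N → ℝ, (∀ i, 0 < ε i) →
    ∃ t : Fin N → ℝ, (∀ i, 0 < t i) ∧ MemMultiHat C e p ι x ε t ∧
      ∀ (i : Fin N) (ε' : ℝ), 0 < ε' → ε' < ε i →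
        ∃ t' : ℝ, t i < t' ∧
          MemMultiHat C e p ι x (Function.update ε i ε') (Function.update t i t')}

end Multi

section LevelL

variable {V : Type} [AddCommGroup V] [Module ℂ V] [StarAddMonoid V] [StarModule ℂ V] {N : ℕ}

/-- `P_{i,j}^{N,L} = I_{2^{N(j-1)}} ⊗ P_i^N ⊗ J_{2^{N(L-j)}}`, indexed by `L`-tuples of
binary strings of length `N`. -/
def PmL (e : V) (p : Fin N → V) {L : ℕ} (i : Fin N) (j : Fin L) :
    Matrix (Fin L → Fin N → Fin 2) (Fin L → Fin N → Fin 2) V :=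
  Matrix.of fun σ τ => if ∀ l, l < j → σ l = τ l then Pm e p i (σ j) (τ j) else 0

/-- `Q_{i,j}^{N,L} = I_{2^{N(j-1)}} ⊗ Q_i^N ⊗ J_{2^{N(L-j)}}`. -/
def QmL (e : V) (p : Fin N → V) {L : ℕ} (i : Fin N) (j : Fin L) :
    Matrix (Fin L → Fin N → Fin 2) (Fin L → Fin N → Fin 2) V :=
  Matrix.of fun σ τ => if ∀ l, l < j → σ l = τ l then Qm e p i (σ j) (τ j) else 0

/-- `x + Σ_{i,j} ε_{i,j} (I_ι ⊗ P_{i,j}^{N,L}) + Σ_{i,j} t_{i,j} (I_ι ⊗ Q_{i,j}^{N,L})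
∈ C_{ι·2^{NL}}`. -/
def MemL (C : ConeFamily V) (e : V) (p : Fin N → V) (L : ℕ)
    (ι : Type) [Fintype ι] [DecidableEq ι]
    (x : Matrix (ι × (Fin L → Fin N → Fin 2)) (ι × (Fin L → Fin N → Fin 2)) V)
    (ε t : Fin N × Fin L → ℝ) : Prop :=
  x + ∑ q : Fin N × Fin L, (ε q : ℂ) • idKron (PmL e p q.1 q.2)
    + ∑ q : Fin N × Fin L, (t q : ℂ) • idKron (QmL e p q.1 q.2)
    ∈ C (ι × (Fin L → Fin N → Fin 2))

/-- the cone `C(p_1, …, p_N)^L_ι ⊆ M_{ι·2^{NL}}(V)`. -/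
def coneL (C : ConeFamily V) (e : V) (p : Fin N → V) (L : ℕ)
    (ι : Type) [Fintype ι] [DecidableEq ι] :
    Set (Matrix (ι × (Fin L → Fin N → Fin 2)) (ι × (Fin L → Fin N → Fin 2)) V) :=
  {x | IsHermMat x ∧ ∀ ε : Fin N × Fin L → ℝ, (∀ q, 0 < ε q) →
    ∃ t : Fin N × Fin L → ℝ, (∀ q, 0 < t q) ∧ MemL C e p L ι x ε t ∧
      ∀ (q : Fin N × Fin L) (ε' : ℝ), 0 < ε' → ε' < ε q →
        ∃ t' : ℝ, t q < t' ∧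
          MemL C e p L ι x (Function.update ε q ε') (Function.update t q t')}

/-- the inductive-limit cone `C(p_1, …, p_N)^∞_ι ⊆ M_ι(V)`. -/
def coneInf (C : ConeFamily V) (e : V) (p : Fin N → V)
    (ι : Type) [Fintype ι] [DecidableEq ι] : Set (Matrix ι ι V) :=
  {x | IsHermMat x ∧ ∀ ε : ℝ, 0 < ε → ∃ L : ℕ, 1 ≤ L ∧
    onesKron (κ := Fin L → Fin N → Fin 2) (x + (ε : ℂ) • unitMat e)
      ∈ coneL C e p L ι}

/-- `C(p_1, …, p_N)^∞` as a family of cones. -/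
def coneInfFam (C : ConeFamily V) (e : V) (p : Fin N → V) : ConeFamily V :=
  fun ι _ _ => coneInf C e p ι

end LevelL
section AOU

variable {V : Type} [AddCommGroup V] [Module ℂ V] [StarAddMonoid V] [StarModule ℂ V]

/-- `(V, C, e)` is an Archimedean order unit (AOU) space. -/
structure IsAOU (C : Set V) (e : V) : Prop where
  herm : ∀ v ∈ C, star v = v
  add_mem : ∀ v ∈ C, ∀ w ∈ C, v + w ∈ C
  smul_mem : ∀ r : ℝ, 0 ≤ r → ∀ v ∈ C, (r : ℂ) • v ∈ C
  proper : ∀ v ∈ C, -v ∈ C → v = 0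
  unit_mem : e ∈ C
  orderUnit : ∀ v : V, star v = v → ∃ t : ℝ, 0 < t ∧ (t : ℂ) • e - v ∈ C
  arch : ∀ v : V, (∀ ε : ℝ, 0 < ε → v + (ε : ℂ) • e ∈ C) → v ∈ C

/-- the cone `D^max_ι` of matrices of the form `(Σ_i conj(a(i,s))·a(i,t)·v_i)_{s,t}`
with `v_i ∈ C`. -/
def Dmax (C : Set V) (ι : Type) [Fintype ι] [DecidableEq ι] : Set (Matrix ι ι V) :=
  {x | ∃ (r : ℕ) (a : Fin r → ι → ℂ) (v : Fin r → V), (∀ i, v i ∈ C) ∧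
    x = Matrix.of fun s t => ∑ i, ((starRingEnd ℂ) (a i s) * a i t) • v i}

/-- the maximal matrix ordering `C^max` of the AOU space `(V, C, e)`:
the Archimedeanization of `D^max`. -/
def CmaxFam (C : Set V) (e : V) : ConeFamily V :=
  fun ι _ _ =>
    {x | IsHermMat x ∧ ∀ ε : ℝ, 0 < ε → x + (ε : ℂ) • unitMat e ∈ Dmax C ι}

end AOU
namespace NSpace

variable (n k : ℕ)

/-- index set for the generators `Q̃(a,b|x,y)`. -/
abbrev Idx (n k : ℕ) := Fin k × Fin k × Fin n × Fin n

/-- the free vector space `W̃ = ℂ^{k²n²}`. -/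
abbrev Wt (n k : ℕ) := Idx n k → ℂ

/-- the canonical basis vector `Q̃(a,b|x,y)`. -/
def gen {n k : ℕ} (a b : Fin k) (x y : Fin n) : Wt n k := Pi.single (a, b, x, y) 1

/-- the set of nonsignalling relations. -/
def relSet (n k : ℕ) : Set (Wt n k) :=
  {u | ∃ x y x' y', u = (∑ a, ∑ b, gen a b x y) - (∑ a, ∑ b, gen a b x' y')} ∪
  {u | ∃ a x z w, u = (∑ c, gen a c x z) - (∑ c, gen a c x w)} ∪
  {u | ∃ b y z w, u = (∑ d, gen d b z y) - (∑ d, gen d b w y)}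

/-- the subspace `J` spanned by the nonsignalling relations. -/
noncomputable def Jrel (n k : ℕ) : Submodule ℂ (Wt n k) := Submodule.span ℂ (relSet n k)

/-- the universal nonsignalling vector space `V_ns = W̃ / J`. -/
abbrev Vns (n k : ℕ) := Wt n k ⧸ Jrel n k

/-- the generator `Q(a,b|x,y) = Q̃(a,b|x,y) + J` of `V_ns`. -/
noncomputable def Qg {n k : ℕ} (a b : Fin k) (x y : Fin n) : Vns n k :=
  Submodule.Quotient.mk (gen a b x y)

/-- the unit `e_ns = Σ_{a,b} Q(a,b|x,y)` of `V_ns`. -/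
noncomputable def ens (n k : ℕ) [NeZero n] : Vns n k := ∑ a, ∑ b, Qg (n := n) (k := k) a b 0 0

/-- the coordinatewise conjugation on `W̃`. -/
def starW (n k : ℕ) : Wt n k → Wt n k := fun w i => (starRingEnd ℂ) (w i)

theorem starW_gen {n k : ℕ} (a b : Fin k) (x y : Fin n) :
    starW n k (gen a b x y) = gen a b x y := by
  funext i
  by_cases h : i = (a, b, x, y) <;> simp [starW, gen, Pi.single_apply, h]

theorem starW_mem_Jrel {n k : ℕ} {u : Wt n k} (hu : u ∈ Jrel n k) :
    starW n k u ∈ Jrel n k := by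
  have hsub : ∀ u v : Wt n k, starW n k (u - v) = starW n k u - starW n k v := by
    intro u v; funext i; simp [starW]
  have hsum : ∀ {α : Type} (s : Finset α) (f : α → Wt n k),
      starW n k (∑ j ∈ s, f j) = ∑ j ∈ s, starW n k (f j) := by
    intro α s f; funext i
    simp [starW, Finset.sum_apply, map_sum]
  induction hu using Submodule.span_induction with
  | mem s hs =>
    have hfix : starW n k s = s := by
      rcases hs with (⟨x, y, x', y', rfl⟩ | ⟨a, x, z, w, rfl⟩) | ⟨b, y, z, w, rfl⟩ <;>
        simp [hsub, hsum, starW_gen]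
    rw [hfix]; exact Submodule.subset_span hs
  | zero =>
    have : starW n k 0 = 0 := by funext i; simp [starW]
    rw [this]; exact zero_mem _
  | add u v _ _ ihu ihv =>
    have : starW n k (u + v) = starW n k u + starW n k v := by
      funext i; simp [starW]
    rw [this]; exact add_mem ihu ihv
  | smul c u _ ih =>
    have : starW n k (c • u) = (starRingEnd ℂ) c • starW n k u := by
      funext i; simp [starW]
    rw [this]; exact Submodule.smul_mem _ _ ih

/-- the conjugate-linear involution on `V_ns` fixing each generator. -/
noncomputable def starVns {n k : ℕ} : Vns n k → Vns n k := fun v =>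
  Quotient.liftOn' v
    (fun w => (Submodule.Quotient.mk (starW n k w) : Vns n k))
    (fun a b hab => by
      rw [Submodule.quotientRel_def] at hab
      apply Quotient.sound'
      rw [Submodule.quotientRel_def]
      have h : starW n k a - starW n k b = starW n k (a - b) := by
        funext i; simp [starW]
      rw [h]
      exact starW_mem_Jrel hab)

noncomputable instance {n k : ℕ} : StarAddMonoid (Vns n k) where
  star := starVns
  star_involutive := by
    intro v
    obtain ⟨w, rfl⟩ := Submodule.Quotient.mk_surjective _ v
    show Submodule.Quotient.mk (starW n k (starW n k w)) = Submodule.Quotient.mk w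
    congr 1
    funext i; simp [starW]
  star_add := by
    intro v v'
    obtain ⟨w, rfl⟩ := Submodule.Quotient.mk_surjective _ v
    obtain ⟨w', rfl⟩ := Submodule.Quotient.mk_surjective _ v'
    show Submodule.Quotient.mk (starW n k (w + w')) =
      (Submodule.Quotient.mk (starW n k w) : Vns n k) + Submodule.Quotient.mk (starW n k w')
    rw [← Submodule.Quotient.mk_add]
    congr 1
    funext i; simp [starW]

instance {n k : ℕ} : StarModule ℂ (Vns n k) where
  star_smul := by
    intro c v
    obtain ⟨w, rfl⟩ := Submodule.Quotient.mk_surjective _ v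
    show Submodule.Quotient.mk (starW n k (c • w)) =
      star c • (Submodule.Quotient.mk (starW n k w) : Vns n k)
    rw [← Submodule.Quotient.mk_smul]
    congr 1
    funext i; simp [starW, mul_comm]

theorem star_Qg {n k : ℕ} (a b : Fin k) (x y : Fin n) :
    star (Qg a b x y) = Qg a b x y := by
  show Submodule.Quotient.mk (starW n k (gen a b x y)) = Qg a b x y
  rw [starW_gen]; rfl

/-- the cone `D_ns` generated by the generators `Q(a,b|x,y)`. -/
def Dns (n k : ℕ) : Set (Vns n k) :=
  {v | ∃ t : Idx n k → ℝ, (∀ i, 0 ≤ t i) ∧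
    v = ∑ i : Idx n k, (t i : ℂ) • Qg i.1 i.2.1 i.2.2.1 i.2.2.2}

end NSpace

open NSpace

/-- an enumeration `p_1, …, p_N` of the generators of `V_ns`, given by a bijection
`σ : Fin N ≃ [k]×[k]×[n]×[n]`. -/
noncomputable def genEnum {n k N : ℕ} (σ : Fin N ≃ Idx n k) : Fin N → Vns n k :=
  fun i => Qg (σ i).1 (σ i).2.1 (σ i).2.2.1 (σ i).2.2.2

section MaxCone

variable {V : Type} [AddCommGroup V] [Module ℂ V] [StarAddMonoid V] [StarModule ℂ V]
  {C : Set V} {β γ : Type} [Fintype β] [DecidableEq β] [Fintype γ] [DecidableEq γ]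

theorem mem_Dmax_of_fintype {α : Type} [Fintype α] (a : α → β → ℂ) (v : α → V)
    (hv : ∀ i, v i ∈ C) {x : Matrix β β V}
    (hx : ∀ s t, x s t = ∑ i, ((starRingEnd ℂ) (a i s) * a i t) • v i) : x ∈ Dmax C β := by
  refine ⟨Fintype.card α, fun i => a ((Fintype.equivFin α).symm i),
    fun i => v ((Fintype.equivFin α).symm i), fun i => hv _, ?_⟩
  ext s t
  rw [hx]
  exact (Equiv.sum_comp (Fintype.equivFin α).symm
    (fun i => ((starRingEnd ℂ) (a i s) * a i t) • v i)).symm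

theorem Dmax_zero : (0 : Matrix β β V) ∈ Dmax C β :=
  mem_Dmax_of_fintype (α := Empty) (fun i => i.elim) (fun i => i.elim) (fun i => i.elim)
    (by simp)

theorem Dmax_add {x y : Matrix β β V} (hx : x ∈ Dmax C β) (hy : y ∈ Dmax C β) :
    x + y ∈ Dmax C β := by
  obtain ⟨r, a, v, hv, rfl⟩ := hx
  obtain ⟨r', a', v', hv', rfl⟩ := hy
  refine mem_Dmax_of_fintype (Sum.elim a a') (Sum.elim v v') ?_ ?_
  · rintro (i | i)
    · exact hv i
    · exact hv' i
  · intro s t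
    simp [Fintype.sum_sum_type]

theorem Dmax_sum {α : Type} (S : Finset α) {x : α → Matrix β β V}
    (hx : ∀ i ∈ S, x i ∈ Dmax C β) : ∑ i ∈ S, x i ∈ Dmax C β := by
  classical
  induction S using Finset.induction_on with
  | empty => simpa using Dmax_zero
  | insert i S hi ih =>
    rw [Finset.sum_insert hi]
    exact Dmax_add (hx i (Finset.mem_insert_self i S))
      (ih fun j hj => hx j (Finset.mem_insert_of_mem hj))

theorem Dmax_smul {x : Matrix β β V} (hx : x ∈ Dmax C β) {r : ℝ} (hr : 0 ≤ r) :
    (r : ℂ) • x ∈ Dmax C β := by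
  obtain ⟨m, a, v, hv, rfl⟩ := hx
  refine ⟨m, fun i s => ((√r : ℝ) : ℂ) * a i s, v, hv, ?_⟩
  have h : ((√r : ℝ) : ℂ) * ((√r : ℝ) : ℂ) = r := by
    rw [← Complex.ofReal_mul, Real.mul_self_sqrt hr]
  ext s t
  simp only [Matrix.smul_apply, Matrix.of_apply, Finset.smul_sum, smul_smul, map_mul,
    Complex.conj_ofReal]
  refine Finset.sum_congr rfl fun i _ => ?_
  congr 1
  rw [← h]
  ring

theorem Dmax_submatrix {x : Matrix β β V} (hx : x ∈ Dmax C β) (f : γ → β) :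
    x.submatrix f f ∈ Dmax C γ := by
  obtain ⟨m, a, v, hv, rfl⟩ := hx
  exact ⟨m, fun i s => a i (f s), v, hv, rfl⟩

theorem isHermMat_of_mem_Dmax (hC : ∀ v ∈ C, star v = v) {x : Matrix β β V}
    (hx : x ∈ Dmax C β) : IsHermMat x := by
  obtain ⟨m, a, v, hv, rfl⟩ := hx
  intro s t
  simp only [Matrix.of_apply, star_sum, star_smul]
  refine Finset.sum_congr rfl fun i _ => ?_
  rw [hC _ (hv i)]
  simp [mul_comm]

/-- The matrix with `(s,t)` entry `u s * u t • v` if `g s = g t`, and `0` otherwise. -/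
def kerMat {X : Type} [DecidableEq X] (g : β → X) (u : β → ℝ) (v : V) : Matrix β β V :=
  Matrix.of fun s t => if g s = g t then ((u s * u t : ℝ) : ℂ) • v else 0

theorem kerMat_mem {X : Type} [Fintype X] [DecidableEq X] (g : β → X) (u : β → ℝ) {v : V}
    (hv : v ∈ C) : kerMat g u v ∈ Dmax C β := by
  refine mem_Dmax_of_fintype (fun x s => if g s = x then ((u s : ℝ) : ℂ) else 0)
    (fun _ => v) (fun _ => hv) fun s t => ?_
  simp only [kerMat, Matrix.of_apply, apply_ite (starRingEnd ℂ), Complex.conj_ofReal, map_zero,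
    mul_ite, ite_mul, zero_mul, mul_zero, ite_smul, zero_smul, Finset.sum_ite_eq,
    Finset.mem_univ, if_true]
  by_cases h : g s = g t <;> simp [h]

/-- Passing to a coarser partition is dominated by a multiple of the finer one. -/
theorem card_smul_kerMat_sub_mem {X Y : Type} [Fintype X] [DecidableEq X] [DecidableEq Y]
    (g : β → X) (h : X → Y) (u : β → ℝ) {v : V} (hv : v ∈ C) :
    ((Fintype.card X : ℝ) : ℂ) • kerMat g u v - kerMat (fun s => h (g s)) u v
      ∈ Dmax C β := by
  let A : X → β → ℝ := fun x s => if g s = x then u s else 0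
  let c : X × X → ℝ := fun q => if h q.1 = h q.2 then 1 else 0
  have hA : ∀ s t, ∑ x, A x s * A x t = if g s = g t then u s * u t else 0 := by
    intro s t
    by_cases hst : g s = g t <;> simp [A, hst, eq_comm]
  have hAB : ∀ s t, ∑ q : X × X, c q * (A q.1 s * A q.2 t) =
      if h (g s) = h (g t) then u s * u t else 0 := by
    intro s t
    simp [A, c, Fintype.sum_prod_type]
  have key : ∀ s t, ∑ q : X × X, ((A q.1 s - c q * A q.2 s) * (A q.1 t - c q * A q.2 t)
      + ((1 - c q) * A q.2 s) * ((1 - c q) * A q.2 t)) =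
      2 * (Fintype.card X * (if g s = g t then u s * u t else 0)
        - if h (g s) = h (g t) then u s * u t else 0) := by
    intro s t
    have h1 : ∑ q : X × X, A q.1 s * A q.1 t =
        Fintype.card X * if g s = g t then u s * u t else 0 := by
      rw [Fintype.sum_prod_type, ← hA s t, Finset.mul_sum]
      simp
    have h2 : ∑ q : X × X, A q.2 s * A q.2 t =
        Fintype.card X * if g s = g t then u s * u t else 0 := by
      rw [Fintype.sum_prod_type_right, ← hA s t, Finset.mul_sum]
      simp
    have h3 := hAB s t
    have h4 := hAB t s
    have hexp : ∀ q : X × X, (A q.1 s - c q * A q.2 s) * (A q.1 t - c q * A q.2 t)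
      + ((1 - c q) * A q.2 s) * ((1 - c q) * A q.2 t) =
      A q.1 s * A q.1 t + A q.2 s * A q.2 t - c q * (A q.1 s * A q.2 t)
        - c q * (A q.1 t * A q.2 s) := by
      intro q
      by_cases hq : h q.1 = h q.2
      · simp only [c, hq, if_true]; ring
      · simp only [c, hq, if_false]; ring
    rw [Finset.sum_congr rfl fun q _ => hexp q, Finset.sum_sub_distrib, Finset.sum_sub_distrib,
      Finset.sum_add_distrib, h1, h2, h3, h4]
    by_cases hh : h (g s) = h (g t)
    · simp only [hh, if_true]; ring
    · simp only [hh, Ne.symm hh, if_false]; ring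
  have hmem : (Matrix.of fun s t => ((2 * (Fintype.card X * (if g s = g t then u s * u t else 0)
        - if h (g s) = h (g t) then u s * u t else 0) : ℝ) : ℂ) • v : Matrix β β V)
      ∈ Dmax C β := by
    refine mem_Dmax_of_fintype (α := (X × X) ⊕ (X × X))
      (Sum.elim (fun q s => ((A q.1 s - c q * A q.2 s : ℝ) : ℂ))
        (fun q s => (((1 - c q) * A q.2 s : ℝ) : ℂ))) (fun _ => v) (fun _ => hv) fun s t => ?_
    rw [← Finset.sum_smul, Matrix.of_apply, ← key s t, Fintype.sum_sum_type,
      Finset.sum_add_distrib]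
    simp only [Sum.elim_inl, Sum.elim_inr, Complex.conj_ofReal]
    push_cast
    rfl
  convert Dmax_smul hmem (r := 1 / 2) (by norm_num) using 1
  ext s t
  simp only [kerMat, Matrix.sub_apply, Matrix.smul_apply, Matrix.of_apply, smul_smul]
  rw [← Complex.ofReal_mul, ← mul_assoc]
  by_cases h1 : g s = g t
  · simp [h1, sub_smul, smul_smul]
  · by_cases h2 : h (g s) = h (g t) <;> simp [h1, h2]

/-- The one-step estimate: adding `η P + η⁻¹ Q` refines the partition `g` by the bit `b`. -/
theorem kerMat_refine_mem {X Y : Type} [Fintype X] [DecidableEq X] [DecidableEq Y]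
    (g : β → X) (g' : β → Y) (b : β → Fin 2)
    (hg : ∀ s t, g' s = g' t ↔ g s = g t ∧ b s = b t)
    {e p : V} (hp : p ∈ C) (hp' : e - p ∈ C) {η : ℝ} (hη : 0 < η) :
    kerMat g 1 e - kerMat g' 1 e
      + (η : ℂ) • (kerMat g' (fun s => if b s = 0 then 1 else 0) p
        + kerMat g' (fun s => if b s = 0 then 0 else 1) (e - p))
      + ((η⁻¹ : ℝ) : ℂ) • (kerMat g' (fun s => if b s = 0 then 1 else 0) (e - p)
        + kerMat g' (fun s => if b s = 0 then 0 else 1) p) ∈ Dmax C β := by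
  have h := Dmax_add (kerMat_mem (C := C) g (fun s => if b s = 0 then √η else √η⁻¹) hp)
    (kerMat_mem (C := C) g (fun s => if b s = 0 then √η⁻¹ else √η) hp')
  convert h using 1
  ext s t
  have h1 : √η * √η = η := Real.mul_self_sqrt hη.le
  have h2 : √η⁻¹ * √η⁻¹ = η⁻¹ := Real.mul_self_sqrt (inv_pos.2 hη).le
  have h3 : √η * √η⁻¹ = 1 := by
    rw [← Real.sqrt_mul hη.le, mul_inv_cancel₀ hη.ne', Real.sqrt_one]
  have h4 : √η⁻¹ * √η = 1 := by rw [mul_comm, h3]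
  have hb : ∀ i : Fin 2, i = 0 ∨ i = 1 := by decide
  by_cases hst : g s = g t
  · rcases hb (b s) with hs | hs <;> rcases hb (b t) with ht | ht <;>
      simp only [kerMat, Matrix.add_apply, Matrix.sub_apply, Matrix.smul_apply, Matrix.of_apply,
        hg, hst, hs, ht, Pi.one_apply, if_true, one_ne_zero, zero_ne_one, if_false, and_true,
        and_false, h1, h2, h3, h4] <;> simp
    all_goals abel
  · simp [kerMat, hg, hst]

end MaxCone

section BitStrings

variable {V : Type} [AddCommGroup V] [Module ℂ V] [StarAddMonoid V] [StarModule ℂ V]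
  {C : Set V} {ι : Type} [Fintype ι] [DecidableEq ι] {N L : ℕ}

/-- Erase all bits except those whose lexicographic position `i + N * j` is below `m`. -/
def truncBits (m : ℕ) (a : ι × (Fin L → Fin N → Fin 2)) : ι × (Fin L → Fin N → Fin 2) :=
  (a.1, fun j i => if i.1 + N * j.1 < m then a.2 j i else 0)

theorem truncBits_eq_iff {m : ℕ} {a b : ι × (Fin L → Fin N → Fin 2)} :
    truncBits m a = truncBits m b ↔
      a.1 = b.1 ∧ ∀ j i, i.1 + N * j.1 < m → a.2 j i = b.2 j i := by
  simp only [truncBits, Prod.mk.injEq, funext_iff]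
  refine and_congr_right fun _ => forall_congr' fun j => forall_congr' fun i => ?_
  by_cases h : i.1 + N * j.1 < m <;> simp [h]

theorem lex_lt_iff {i i' : Fin N} {j j' : Fin L} :
    i'.1 + N * j'.1 < i.1 + N * j.1 ↔ j' < j ∨ j' = j ∧ i' < i := by
  have hi := i.2
  have hi' := i'.2
  rcases lt_trichotomy j' j with h | rfl | h
  · have h2 : N * (j'.1 + 1) ≤ N * j.1 := Nat.mul_le_mul_left N h
    rw [Nat.mul_add] at h2
    simp only [h, true_or, iff_true]
    omega
  · simp
  · have h2 : N * (j.1 + 1) ≤ N * j'.1 := Nat.mul_le_mul_left N h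
    rw [Nat.mul_add] at h2
    simp only [h.not_gt, h.ne', false_and, or_false, iff_false]
    omega

theorem lex_lt_succ_iff {i i' : Fin N} {j j' : Fin L} :
    i'.1 + N * j'.1 < i.1 + N * j.1 + 1 ↔ j' < j ∨ j' = j ∧ i' ≤ i := by
  have h := lex_lt_iff (i := i') (i' := i) (j := j') (j' := j)
  rw [Nat.lt_succ_iff, ← not_lt, h, not_or, not_and, not_lt, not_lt, le_iff_lt_or_eq]
  constructor
  · rintro ⟨h1 | h1, h2⟩
    · exact Or.inl h1
    · exact Or.inr ⟨h1, h2 h1.symm⟩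
  · rintro (h1 | ⟨h1, h2⟩)
    · exact ⟨Or.inl h1, fun h3 => absurd h3 h1.ne'⟩
    · exact ⟨Or.inr h1, fun _ => h2⟩

theorem truncBits_succ_eq_iff_lex {i : Fin N} {j : Fin L} {a b : ι × (Fin L → Fin N → Fin 2)} :
    truncBits (i.1 + N * j.1 + 1) a = truncBits (i.1 + N * j.1 + 1) b ↔
      a.1 = b.1 ∧ (∀ l, l < j → a.2 l = b.2 l) ∧
        (∀ d, d < i → a.2 j d = b.2 j d) ∧ a.2 j i = b.2 j i := by
  rw [truncBits_eq_iff]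
  refine and_congr_right fun _ => ⟨fun h => ⟨fun l hl => ?_, fun d hd => ?_, ?_⟩, ?_⟩
  · exact funext fun d => h l d (lex_lt_succ_iff.2 (Or.inl hl))
  · exact h j d (lex_lt_succ_iff.2 (Or.inr ⟨rfl, hd.le⟩))
  · exact h j i (Nat.lt_succ_self _)
  · rintro ⟨h1, h2, h3⟩ l d hd
    rcases lex_lt_succ_iff.1 hd with hl | ⟨rfl, hl⟩
    · rw [h1 l hl]
    · rcases hl.lt_or_eq with hl | rfl
      · exact h2 d hl
      · exact h3

theorem truncBits_succ_eq_iff {i : Fin N} {j : Fin L} {a b : ι × (Fin L → Fin N → Fin 2)} :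
    truncBits (i.1 + N * j.1 + 1) a = truncBits (i.1 + N * j.1 + 1) b ↔
      truncBits (i.1 + N * j.1) a = truncBits (i.1 + N * j.1) b ∧ a.2 j i = b.2 j i := by
  rw [truncBits_succ_eq_iff_lex, truncBits_eq_iff]
  constructor
  · rintro ⟨h0, h1, h2, h3⟩
    refine ⟨⟨h0, fun l d hd => ?_⟩, h3⟩
    rcases lex_lt_iff.1 hd with hl | ⟨rfl, hl⟩
    · rw [h1 l hl]
    · exact h2 d hl
  · rintro ⟨⟨h0, h1⟩, h3⟩
    exact ⟨h0, fun l hl => funext fun d => h1 l d (lex_lt_iff.2 (Or.inl hl)),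
      fun d hd => h1 j d (lex_lt_iff.2 (Or.inr ⟨rfl, hd⟩)), h3⟩

theorem idKron_PmL (e : V) (p : Fin N → V) (i : Fin N) (j : Fin L) :
    (idKron (PmL e p i j) : Matrix (ι × (Fin L → Fin N → Fin 2)) _ V) =
      kerMat (truncBits (i.1 + N * j.1 + 1)) (fun a => if a.2 j i = 0 then 1 else 0) (p i)
      + kerMat (truncBits (i.1 + N * j.1 + 1)) (fun a => if a.2 j i = 0 then 0 else 1)
        (e - p i) := by
  ext a b
  simp only [idKron, PmL, Pm, kerMat, Matrix.of_apply, Matrix.add_apply,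
    truncBits_succ_eq_iff_lex]
  by_cases h1 : a.1 = b.1 <;> by_cases h2 : ∀ l, l < j → a.2 l = b.2 l <;>
    by_cases h3 : ∀ d, d < i → a.2 j d = b.2 j d <;>
    by_cases h4 : a.2 j i = b.2 j i <;> by_cases h5 : b.2 j i = 0 <;>
    simp +contextual [h1, h2, h3, h4, h5]

theorem idKron_QmL (e : V) (p : Fin N → V) (i : Fin N) (j : Fin L) :
    (idKron (QmL e p i j) : Matrix (ι × (Fin L → Fin N → Fin 2)) _ V) =
      kerMat (truncBits (i.1 + N * j.1 + 1)) (fun a => if a.2 j i = 0 then 1 else 0) (e - p i)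
      + kerMat (truncBits (i.1 + N * j.1 + 1)) (fun a => if a.2 j i = 0 then 0 else 1)
        (p i) := by
  ext a b
  simp only [idKron, QmL, Qm, kerMat, Matrix.of_apply, Matrix.add_apply,
    truncBits_succ_eq_iff_lex]
  by_cases h1 : a.1 = b.1 <;> by_cases h2 : ∀ l, l < j → a.2 l = b.2 l <;>
    by_cases h3 : ∀ d, d < i → a.2 j d = b.2 j d <;>
    by_cases h4 : a.2 j i = b.2 j i <;> by_cases h5 : b.2 j i = 0 <;>
    simp +contextual [h1, h2, h3, h4, h5]

theorem unitMat_eq_kerMat {β : Type} [DecidableEq β] (e : V) :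
    (unitMat e : Matrix β β V) = kerMat id 1 e := by
  ext s t
  simp [unitMat, kerMat]

theorem unitMat_mem_Dmax {β : Type} [Fintype β] [DecidableEq β] {e : V} (he : e ∈ C) :
    (unitMat e : Matrix β β V) ∈ Dmax C β := by
  rw [unitMat_eq_kerMat]
  exact kerMat_mem _ _ he

theorem idKron_QmL_mem {e : V} {p : Fin N → V} {i : Fin N} (hp : p i ∈ C) (hp' : e - p i ∈ C)
    (j : Fin L) : (idKron (QmL e p i j) : Matrix (ι × (Fin L → Fin N → Fin 2)) _ V)
      ∈ Dmax C (ι × (Fin L → Fin N → Fin 2)) := by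
  rw [idKron_QmL]
  exact Dmax_add (kerMat_mem _ _ hp') (kerMat_mem _ _ hp)

theorem card_smul_unitMat_sub_PmL_mem {e : V} {p : Fin N → V} {i : Fin N} (hp : p i ∈ C)
    (hp' : e - p i ∈ C) (j : Fin L) :
    ((Fintype.card (ι × (Fin L → Fin N → Fin 2)) : ℝ) : ℂ) • unitMat e - idKron (PmL e p i j)
      ∈ Dmax C (ι × (Fin L → Fin N → Fin 2)) := by
  let β := ι × (Fin L → Fin N → Fin 2)
  let u₀ : β → ℝ := fun a => if a.2 j i = 0 then 1 else 0
  let u₁ : β → ℝ := fun a => if a.2 j i = 0 then 0 else 1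
  have h0 := card_smul_kerMat_sub_mem (id : β → β) (truncBits (i.1 + N * j.1 + 1)) u₀ hp
  have h1 := card_smul_kerMat_sub_mem (id : β → β) (truncBits (i.1 + N * j.1 + 1)) u₁ hp'
  have h2 := Dmax_smul (Dmax_add (kerMat_mem (id : β → β) u₀ hp') (kerMat_mem (id : β → β) u₁ hp))
    (Nat.cast_nonneg (Fintype.card β))
  have hu : (unitMat e : Matrix β β V) = kerMat id u₀ (p i) + kerMat id u₁ (e - p i) +
      (kerMat id u₀ (e - p i) + kerMat id u₁ (p i)) := by
    ext s t
    by_cases hst : s = t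
    · by_cases h : t.2 j i = 0 <;> simp [hst, h, unitMat, kerMat, u₀, u₁]
    · simp [hst, unitMat, kerMat]
  rw [idKron_PmL, hu]
  convert Dmax_add (Dmax_add h0 h1) h2 using 1
  simp only [id, smul_add]
  abel

/-- Read off, from a bit string with `L * N` blocks, the bit of label `ρ i` in the block
`i + N * j`. -/
def restrictBits (ρ : Fin N → Fin N) (a : ι × (Fin (L * N) → Fin N → Fin 2)) :
    ι × (Fin L → Fin N → Fin 2) :=
  (a.1, fun j i => a.2 (finProdFinEquiv (j, i)) (ρ i))

theorem truncBits_restrictBits (ρ : Fin N → Fin N) (i : Fin N) (j : Fin L)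
    (a : ι × (Fin (L * N) → Fin N → Fin 2)) :
    truncBits (i.1 + N * j.1 + 1) (restrictBits ρ
      (truncBits ((ρ i).1 + N * (finProdFinEquiv (j, i)).1 + 1) a)) =
    truncBits (i.1 + N * j.1 + 1) (restrictBits ρ a) := by
  rw [truncBits_eq_iff]
  refine ⟨rfl, fun l d hd => ?_⟩
  have : (ρ d).1 + N * (finProdFinEquiv (l, d)).1 < (ρ i).1 + N * (finProdFinEquiv (j, i)).1 + 1 := by
    rw [lex_lt_succ_iff]
    rcases (Nat.lt_succ_iff.1 hd).lt_or_eq with h | h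
    · left
      rw [Fin.lt_def]
      simpa using h
    · right
      have h2 : finProdFinEquiv (l, d) = finProdFinEquiv (j, i) := Fin.ext (by simpa using h)
      have h3 := finProdFinEquiv.injective h2
      simp only [Prod.mk.injEq] at h3
      refine ⟨h2, ?_⟩
      rw [h3.2]
  simp only [restrictBits, truncBits]
  rw [if_pos this]

theorem card_smul_QmL_sub_submatrix_mem {e : V} {p p' : Fin N → V} {ρ : Fin N → Fin N}
    {i : Fin N} (hρ : p' (ρ i) = p i) (hp : p i ∈ C) (hp' : e - p i ∈ C) (j : Fin L) :
    ((Fintype.card (ι × (Fin (L * N) → Fin N → Fin 2)) : ℝ) : ℂ) •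
        idKron (QmL e p' (ρ i) (finProdFinEquiv (j, i)))
      - (idKron (QmL e p i j)).submatrix (restrictBits ρ) (restrictBits ρ)
      ∈ Dmax C (ι × (Fin (L * N) → Fin N → Fin 2)) := by
  let β := ι × (Fin (L * N) → Fin N → Fin 2)
  let g : β → β := truncBits ((ρ i).1 + N * (finProdFinEquiv (j, i)).1 + 1)
  let h : β → ι × (Fin L → Fin N → Fin 2) :=
    fun a => truncBits (i.1 + N * j.1 + 1) (restrictBits ρ a)
  let u₀ : β → ℝ := fun a => if a.2 (finProdFinEquiv (j, i)) (ρ i) = 0 then 1 else 0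
  let u₁ : β → ℝ := fun a => if a.2 (finProdFinEquiv (j, i)) (ρ i) = 0 then 0 else 1
  have hh : (fun a => h (g a)) = h := funext fun a => truncBits_restrictBits ρ i j a
  have h0 := card_smul_kerMat_sub_mem g h u₀ hp'
  have h1 := card_smul_kerMat_sub_mem g h u₁ hp
  rw [hh] at h0 h1
  rw [idKron_QmL, idKron_QmL, hρ]
  convert Dmax_add h0 h1 using 1
  rw [Matrix.submatrix_add, smul_add]
  exact add_sub_add_comm _ _ _ _

theorem card_smul_unitMat_sub_submatrix_mem {β γ : Type} [Fintype β] [DecidableEq β]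
    [DecidableEq γ] {e : V} (he : e ∈ C) (f : β → γ) :
    ((Fintype.card β : ℝ) : ℂ) • unitMat e - (unitMat e : Matrix γ γ V).submatrix f f
      ∈ Dmax C β := by
  have h := card_smul_kerMat_sub_mem (id : β → β) f 1 he
  rw [unitMat_eq_kerMat, unitMat_eq_kerMat]
  exact h

/-- Adding all the `P`- and `Q`-terms refines `e ⊗ J` to the full matrix unit. -/
theorem onesKron_unitMat_sub_unitMat_mem {e : V} {p : Fin N → V} (hp : ∀ i, p i ∈ C)
    (hp' : ∀ i, e - p i ∈ C) {η : Fin N × Fin L → ℝ} (hη : ∀ q, 0 < η q) :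
    onesKron (unitMat e : Matrix ι ι V) - unitMat e
      + ∑ q : Fin N × Fin L, (η q : ℂ) • idKron (PmL e p q.1 q.2)
      + ∑ q : Fin N × Fin L, (((η q)⁻¹ : ℝ) : ℂ) • idKron (QmL e p q.1 q.2)
      ∈ Dmax C (ι × (Fin L → Fin N → Fin 2)) := by
  let E : ℕ → Matrix (ι × (Fin L → Fin N → Fin 2)) (ι × (Fin L → Fin N → Fin 2)) V :=
    fun m => kerMat (truncBits m) 1 e
  have hE : ∑ q : Fin N × Fin L, (E (q.1.1 + N * q.2.1) - E (q.1.1 + N * q.2.1 + 1)) =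
      onesKron (unitMat e : Matrix ι ι V) - unitMat e := by
    have h1 : ∑ q : Fin N × Fin L, (E (q.1.1 + N * q.2.1) - E (q.1.1 + N * q.2.1 + 1)) =
        ∑ m : Fin (L * N), (E m - E (m + 1)) :=
      Fintype.sum_equiv ((Equiv.prodComm _ _).trans finProdFinEquiv) _ _ fun q => rfl
    have h2 : E 0 = onesKron (unitMat e : Matrix ι ι V) := by
      ext a b
      simp [E, kerMat, onesKron, unitMat, truncBits_eq_iff]
    have h3 : E (L * N) = unitMat e := by
      ext a b
      have h : ∀ (j : Fin L) (i : Fin N), i.1 + N * j.1 < L * N := fun j i =>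
        (finProdFinEquiv (j, i)).2
      have hab : truncBits (L * N) a = truncBits (L * N) b ↔ a = b := by
        rw [truncBits_eq_iff]
        simp [h, Prod.ext_iff, funext_iff]
      simp [E, kerMat, unitMat, hab]
    rw [h1, Fin.sum_univ_eq_sum_range (fun m => E m - E (m + 1)), Finset.sum_range_sub', h2, h3]
  rw [← hE, ← Finset.sum_add_distrib, ← Finset.sum_add_distrib]
  refine Dmax_sum _ fun q _ => ?_
  rw [idKron_PmL, idKron_QmL]
  exact kerMat_refine_mem (truncBits (q.1.1 + N * q.2.1)) _ (fun a => a.2 q.2 q.1)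
    (fun _ _ => truncBits_succ_eq_iff) (hp q.1) (hp' q.1) (hη q)

end BitStrings

section Transfer

variable {V : Type} [AddCommGroup V] [Module ℂ V] [StarAddMonoid V] [StarModule ℂ V]
  {C : Set V} {ι : Type} [Fintype ι] [DecidableEq ι] {N L : ℕ} {e : V} {p p' : Fin N → V}

theorem isHermMat_add {ι : Type} {x y : Matrix ι ι V} (hx : IsHermMat x) (hy : IsHermMat y) :
    IsHermMat (x + y) := fun i j => by
  simp [hx i j, hy i j]

theorem isHermMat_smul_unitMat (he : star e = e) (r : ℝ) :
    IsHermMat ((r : ℂ) • unitMat e : Matrix ι ι V) := fun i j => by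
  by_cases h : i = j
  · simp [unitMat, h, he]
  · simp [unitMat, h, Ne.symm h]

theorem Dmax_subset_CmaxFam (hC : ∀ v ∈ C, star v = v) (he : e ∈ C) :
    Dmax C ι ⊆ CmaxFam C e ι := fun _ hx =>
  ⟨isHermMat_of_mem_Dmax hC hx,
    fun _ hε => Dmax_add hx (Dmax_smul (unitMat_mem_Dmax he) hε.le)⟩

theorem onesKron_add_mem_coneL (hC : ∀ v ∈ C, star v = v) (he : e ∈ C) (hp : ∀ i, p i ∈ C)
    (hp' : ∀ i, e - p i ∈ C) {y : Matrix ι ι V} (hy : IsHermMat y) {δ : ℝ} (hδ : 0 < δ)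
    {t : Fin N × Fin L → ℝ} (ht : ∀ q, 0 ≤ t q)
    (h : onesKron y + (δ : ℂ) • unitMat e
      + ∑ q : Fin N × Fin L, (t q : ℂ) • idKron (QmL e p q.1 q.2)
      ∈ Dmax C (ι × (Fin L → Fin N → Fin 2))) :
    onesKron (κ := Fin L → Fin N → Fin 2) (y + (δ : ℂ) • unitMat e)
      ∈ coneL (CmaxFam C e) e p L ι := by
  have key : ∀ ε : Fin N × Fin L → ℝ, (∀ q, 0 < ε q) →
      MemL (CmaxFam C e) e p L ι (onesKron (y + (δ : ℂ) • unitMat e)) ε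
        (fun q => t q + δ * (δ / ε q)) := by
    intro ε hε
    have h2 := Dmax_smul (onesKron_unitMat_sub_unitMat_mem (C := C) (ι := ι) hp hp'
      (η := fun q => ε q / δ) fun q => div_pos (hε q) hδ) hδ.le
    refine Dmax_subset_CmaxFam hC he ?_
    convert Dmax_add h h2 using 1
    have h3 : onesKron (κ := Fin L → Fin N → Fin 2) (y + (δ : ℂ) • unitMat e) =
        onesKron y + (δ : ℂ) • onesKron (unitMat e) := rfl
    have h4 : ∀ q, (δ : ℂ) * ((ε q / δ : ℝ) : ℂ) = ε q := fun q => by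
      rw [← Complex.ofReal_mul, mul_div_cancel₀ _ hδ.ne']
    simp only [h3, smul_add, smul_sub, Finset.smul_sum, smul_smul, inv_div, Complex.ofReal_add,
      add_smul, Finset.sum_add_distrib, h4, Complex.ofReal_mul]
    abel
  refine ⟨fun a b => isHermMat_add hy (isHermMat_smul_unitMat (hC e he) δ) a.1 b.1,
    fun ε hε => ⟨_, fun q => ?_, key ε hε, fun q ε' h0 h1 => ⟨t q + δ * (δ / ε'), ?_, ?_⟩⟩⟩
  · have := hε q
    have := ht q
    positivity
  · gcongr
  · convert key (Function.update ε q ε') ?_ using 1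
    · funext r
      by_cases hr : r = q
      · subst hr; simp
      · simp [hr]
    · intro r
      by_cases hr : r = q
      · subst hr; simpa using h0
      · simpa [hr] using hε r

/-- Membership at level `L` for one enumeration passes to level `L * N` for another one. -/
theorem exists_mem_Dmax_of_mem_coneL (he : e ∈ C) (hp : ∀ i, p i ∈ C)
    (hp' : ∀ i, e - p i ∈ C) (hp₂ : ∀ i, p' i ∈ C) (hp₂' : ∀ i, e - p' i ∈ C)
    {ρ : Fin N → Fin N} (hρ : ∀ i, p' (ρ i) = p i) {y : Matrix ι ι V}
    (hy : onesKron (κ := Fin L → Fin N → Fin 2) y ∈ coneL (CmaxFam C e) e p L ι)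
    {δ : ℝ} (hδ : 0 < δ) :
    ∃ t : Fin N × Fin (L * N) → ℝ, (∀ q, 0 ≤ t q) ∧
      onesKron y + (δ : ℂ) • unitMat e
        + ∑ q : Fin N × Fin (L * N), (t q : ℂ) • idKron (QmL e p' q.1 q.2)
        ∈ Dmax C (ι × (Fin (L * N) → Fin N → Fin 2)) := by
  let K₀ : ℝ := Fintype.card (ι × (Fin L → Fin N → Fin 2))
  let K : ℝ := Fintype.card (ι × (Fin (L * N) → Fin N → Fin 2))
  let M : ℝ := Fintype.card (Fin N × Fin L)
  have hK₀ : 0 ≤ K₀ := Nat.cast_nonneg _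
  have hK : 0 ≤ K := Nat.cast_nonneg _
  have hM : 0 ≤ M := Nat.cast_nonneg _
  let c : ℝ := δ / (K + 1)
  have hc : 0 < c := by positivity
  have hcK : 0 ≤ δ - c * K := by
    have : c * (K + 1) = δ := div_mul_cancel₀ _ (by positivity)
    linarith
  let η : ℝ := c / (1 + M * K₀)
  have hη : 0 < η := by positivity
  have hηc : η + M * (η * K₀) = c := by
    have : η * (1 + M * K₀) = c := div_mul_cancel₀ _ (by positivity)
    linarith
  obtain ⟨t, ht, hmem, -⟩ := hy.2 (fun _ => η) fun _ => hη
  have h1 := hmem.2 η hη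
  have h2 : ∑ q : Fin N × Fin L, (η : ℂ) • ((K₀ : ℂ) • unitMat e - idKron (PmL e p q.1 q.2))
      ∈ Dmax C (ι × (Fin L → Fin N → Fin 2)) := Dmax_sum _ fun q _ =>
    Dmax_smul (card_smul_unitMat_sub_PmL_mem (hp _) (hp' _) _) hη.le
  have h3 : onesKron y + (c : ℂ) • unitMat e
      + ∑ q : Fin N × Fin L, (t q : ℂ) • idKron (QmL e p q.1 q.2)
        ∈ Dmax C (ι × (Fin L → Fin N → Fin 2)) := by
    convert Dmax_add h1 h2 using 1
    simp only [smul_sub, Finset.sum_sub_distrib, Finset.sum_const, Finset.card_univ, smul_smul]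
    rw [← hηc, ← Nat.cast_smul_eq_nsmul ℂ, smul_smul]
    push_cast
    rw [add_smul]
    simp only [M, Complex.ofReal_natCast]
    abel
  have h4 := Dmax_submatrix h3 (restrictBits ρ)
  have h5 := Dmax_smul (card_smul_unitMat_sub_submatrix_mem (C := C) he
    (restrictBits (ι := ι) (L := L) ρ)) hc.le
  have h6 : ∑ q : Fin N × Fin L, (t q : ℂ) • ((K : ℂ) •
        idKron (QmL e p' (ρ q.1) (finProdFinEquiv (q.2, q.1)))
      - (idKron (QmL e p q.1 q.2)).submatrix (restrictBits ρ) (restrictBits ρ))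
      ∈ Dmax C (ι × (Fin (L * N) → Fin N → Fin 2)) := Dmax_sum _ fun q _ =>
    Dmax_smul (card_smul_QmL_sub_submatrix_mem (hρ _) (hp _) (hp' _) _) (ht q).le
  have h7 : ∑ q : Fin N × Fin L, (t q : ℂ) • (K : ℂ) •
      (∑ r : Fin N × Fin (L * N), idKron (QmL e p' r.1 r.2)
        - idKron (QmL e p' (ρ q.1) (finProdFinEquiv (q.2, q.1))))
      ∈ Dmax C (ι × (Fin (L * N) → Fin N → Fin 2)) := Dmax_sum _ fun q _ => by
    refine Dmax_smul (Dmax_smul ?_ hK) (ht q).le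
    rw [← Finset.sum_erase_eq_sub (Finset.mem_univ (ρ q.1, finProdFinEquiv (q.2, q.1)))]
    exact Dmax_sum _ fun r _ => idKron_QmL_mem (hp₂ _) (hp₂' _) _
  have h8 := Dmax_smul (unitMat_mem_Dmax (β := ι × (Fin (L * N) → Fin N → Fin 2)) he) hcK
  refine ⟨fun _ => (∑ q, t q) * K, fun _ =>
    mul_nonneg (Finset.sum_nonneg fun q _ => (ht q).le) hK, ?_⟩
  convert Dmax_add (Dmax_add (Dmax_add (Dmax_add h4 h5) h6) h7) h8 using 1
  have h9 : (onesKron y + (c : ℂ) • unitMat e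
      + ∑ q : Fin N × Fin L, (t q : ℂ) • idKron (QmL e p q.1 q.2) :
        Matrix (ι × (Fin L → Fin N → Fin 2)) _ V).submatrix
        (restrictBits ρ) (restrictBits ρ) =
      onesKron y + (c : ℂ) • (unitMat e : Matrix (ι × (Fin L → Fin N → Fin 2)) _ V).submatrix
        (restrictBits ρ) (restrictBits ρ) + ∑ q : Fin N × Fin L, (t q : ℂ) •
        (idKron (QmL e p q.1 q.2)).submatrix (restrictBits ρ) (restrictBits ρ) := by
    ext a b
    simp only [Matrix.submatrix_apply, Matrix.add_apply, Matrix.sum_apply, Matrix.smul_apply]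
    rfl
  rw [h9]
  simp only [smul_sub, Finset.sum_sub_distrib, smul_smul, ← Finset.sum_smul, ← Finset.smul_sum]
  push_cast
  rw [← Finset.sum_mul, sub_smul]
  simp only [K]
  push_cast
  abel

theorem coneInf_subset (hC : ∀ v ∈ C, star v = v) (he : e ∈ C) (hp : ∀ i, p i ∈ C)
    (hp' : ∀ i, e - p i ∈ C) (hp₂ : ∀ i, p' i ∈ C) (hp₂' : ∀ i, e - p' i ∈ C)
    {ρ : Fin N → Fin N} (hρ : ∀ i, p' (ρ i) = p i) (hN : 1 ≤ N) :
    coneInf (CmaxFam C e) e p ι ⊆ coneInf (CmaxFam C e) e p' ι := by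
  rintro x ⟨hx, h⟩
  refine ⟨hx, fun ε hε => ?_⟩
  obtain ⟨L, hL, hmem⟩ := h (ε / 2) (half_pos hε)
  obtain ⟨t, ht, h2⟩ := exists_mem_Dmax_of_mem_coneL he hp hp' hp₂ hp₂' hρ hmem (half_pos hε)
  refine ⟨L * N, Nat.mul_pos hL hN, ?_⟩
  have h3 := onesKron_add_mem_coneL hC he hp₂ hp₂'
    (isHermMat_add hx (isHermMat_smul_unitMat (hC e he) (ε / 2))) (half_pos hε) ht h2
  rwa [add_assoc, ← add_smul, ← Complex.ofReal_add, add_halves] at h3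

end Transfer

section Character

variable {V : Type} [AddCommGroup V] [Module ℂ V] [StarAddMonoid V] [StarModule ℂ V]
  {C : Set V} {e : V} {N : ℕ} {p : Fin N → V}

theorem nonneg_diag_of_mem_Dmax {β : Type} [Fintype β] [DecidableEq β] {φ : V →ₗ[ℂ] ℂ}
    (hφ : ∀ v ∈ C, 0 ≤ φ v) {x : Matrix β β V} (hx : x ∈ Dmax C β) (s : β) : 0 ≤ φ (x s s) := by
  obtain ⟨r, a, v, hv, rfl⟩ := hx
  rw [Matrix.of_apply, map_sum]
  refine Finset.sum_nonneg fun i _ => ?_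
  rw [map_smul, smul_eq_mul]
  exact mul_nonneg (star_mul_self_nonneg (a i s)) (hφ _ (hv i))

theorem complex_nonneg_of_forall_add {z : ℂ} (h : ∀ ε : ℝ, 0 < ε → 0 ≤ z + (ε : ℂ)) :
    0 ≤ z := by
  rw [Complex.le_def]
  constructor
  · refine le_of_forall_pos_le_add fun ε hε => ?_
    simpa using (Complex.le_def.1 (h ε hε)).1
  · simpa using (Complex.le_def.1 (h 1 one_pos)).2

/-- A positive unital functional taking values `0`, `1` on the `p i` is positive on the
inductive-limit cone. -/
theorem nonneg_of_mem_coneInf (he : e ∈ C) (hp : ∀ i, p i ∈ C) (hp' : ∀ i, e - p i ∈ C)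
    {φ : V →ₗ[ℂ] ℂ} (hφ : ∀ v ∈ C, 0 ≤ φ v) (hφe : φ e = 1) (hφp : ∀ i, φ (p i) = 0 ∨ φ (p i) = 1)
    {v : V} (hv : (Matrix.of fun _ _ => v : Matrix (Fin 1) (Fin 1) V)
      ∈ coneInf (CmaxFam C e) e p (Fin 1)) : 0 ≤ φ v := by
  refine complex_nonneg_of_forall_add fun ε hε => ?_
  obtain ⟨L, -, hL⟩ := hv.2 (ε / 2) (half_pos hε)
  obtain ⟨t, -, ht⟩ := exists_mem_Dmax_of_mem_coneL he hp hp' hp hp' (ρ := id) (fun _ => rfl) hL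
    (half_pos hε)
  have key := nonneg_diag_of_mem_Dmax hφ ht
    (0, fun _ i => if φ (p i) = 1 then 0 else 1)
  have hQ : ∀ q : Fin N × Fin (L * N),
      φ ((idKron (ι := Fin 1) (QmL e p q.1 q.2)) (0, fun _ i => if φ (p i) = 1 then 0 else 1)
        (0, fun _ i => if φ (p i) = 1 then 0 else 1)) = 0 := by
    intro q
    rcases hφp q.1 with h | h <;> simp [idKron, QmL, Qm, h, hφe]
  simp only [Matrix.add_apply, Matrix.sum_apply, Matrix.smul_apply, map_add, map_sum, map_smul,
    hQ, smul_zero, Finset.sum_const_zero, add_zero] at key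
  convert key using 1
  simp only [onesKron, unitMat, Matrix.of_apply, Matrix.add_apply, Matrix.smul_apply, if_true,
    map_add, map_smul, hφe, smul_eq_mul, mul_one, add_assoc]
  push_cast
  ring

end Character

namespace NSpace

variable {n k : ℕ}

theorem sum_Qg_left_eq (a : Fin k) (x z w : Fin n) :
    ∑ c, Qg a c x z = ∑ c, Qg a c x w := by
  have h : (∑ c, gen a c x z) - ∑ c, gen a c x w ∈ Jrel n k :=
    Submodule.subset_span (Or.inl (Or.inr ⟨a, x, z, w, rfl⟩))
  simpa [Qg, ← Submodule.mkQ_apply] using (Submodule.Quotient.eq (Jrel n k)).2 h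

theorem sum_Qg_right_eq (b : Fin k) (y z w : Fin n) :
    ∑ d, Qg d b z y = ∑ d, Qg d b w y := by
  have h : (∑ d, gen d b z y) - ∑ d, gen d b w y ∈ Jrel n k :=
    Submodule.subset_span (Or.inr ⟨b, y, z, w, rfl⟩)
  simpa [Qg, ← Submodule.mkQ_apply] using (Submodule.Quotient.eq (Jrel n k)).2 h

theorem sum_Qg_eq_ens [NeZero n] (x y : Fin n) : ∑ a, ∑ b, Qg a b x y = ens n k := by
  have h : (∑ a, ∑ b, gen a b x y) - ∑ a, ∑ b, gen a b 0 0 ∈ Jrel n k :=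
    Submodule.subset_span (Or.inl (Or.inl ⟨x, y, 0, 0, rfl⟩))
  simpa [ens, Qg, ← Submodule.mkQ_apply] using (Submodule.Quotient.eq (Jrel n k)).2 h

theorem star_of_mem_Dns {v : Vns n k} (hv : v ∈ Dns n k) : star v = v := by
  obtain ⟨t, -, rfl⟩ := hv
  rw [star_sum]
  refine Finset.sum_congr rfl fun i _ => ?_
  rw [star_smul, star_Qg]
  simp

theorem Qg_mem_Dns (a b : Fin k) (x y : Fin n) : Qg a b x y ∈ Dns n k := by
  refine ⟨Pi.single (a, b, x, y) 1, fun i => ?_, ?_⟩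
  · rw [Pi.single_apply]; split_ifs <;> norm_num
  · rw [Finset.sum_eq_single (a, b, x, y)]
    · simp
    · intro i _ hi; simp [hi]
    · simp

theorem Dns_sum {α : Type} (S : Finset α) {v : α → Vns n k} (hv : ∀ i ∈ S, v i ∈ Dns n k) :
    ∑ i ∈ S, v i ∈ Dns n k := by
  choose! t ht hvt using hv
  refine ⟨fun j => ∑ i ∈ S, t i j, fun j => Finset.sum_nonneg fun i hi => ht i hi j, ?_⟩
  rw [Finset.sum_congr rfl hvt, Finset.sum_comm]
  simp only [Complex.ofReal_sum, Finset.sum_smul]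

theorem ens_mem_Dns [NeZero n] : ens n k ∈ Dns n k :=
  Dns_sum _ fun _ _ => Dns_sum _ fun _ _ => Qg_mem_Dns _ _ _ _

theorem ens_sub_Qg_mem_Dns [NeZero n] (a b : Fin k) (x y : Fin n) :
    ens n k - Qg a b x y ∈ Dns n k := by
  rw [← sum_Qg_eq_ens x y, ← Fintype.sum_prod_type' (fun a b => Qg a b x y),
    ← Finset.sum_erase_eq_sub (f := fun c : Fin k × Fin k => Qg c.1 c.2 x y)
      (Finset.mem_univ (a, b))]
  exact Dns_sum _ fun _ _ => Qg_mem_Dns _ _ _ _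

/-- The functional `w ↦ ∑ w(f x, g y, x, y)` of a pair of deterministic strategies. -/
def detW (f g : Fin n → Fin k) : Wt n k →ₗ[ℂ] ℂ :=
  ∑ x, ∑ y, LinearMap.proj (f x, g y, x, y)

theorem detW_apply (f g : Fin n → Fin k) (w : Wt n k) :
    detW f g w = ∑ x, ∑ y, w (f x, g y, x, y) := by
  simp [detW]

theorem detW_gen (f g : Fin n → Fin k) (a b : Fin k) (x y : Fin n) :
    detW f g (gen a b x y) = if f x = a ∧ g y = b then 1 else 0 := by
  rw [detW_apply, Finset.sum_eq_single x, Finset.sum_eq_single y]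
  · simp [gen, Pi.single_apply]
  · intro y' _ hy; simp [gen, hy]
  · simp
  · intro x' _ hx; simp [gen, hx]
  · simp

theorem Jrel_le_ker_detW (f g : Fin n → Fin k) : Jrel n k ≤ LinearMap.ker (detW f g) := by
  refine Submodule.span_le.2 ?_
  rintro u ((⟨x, y, x', y', rfl⟩ | ⟨a, x, z, w, rfl⟩) | ⟨b, y, z, w, rfl⟩) <;>
    simp [detW_gen, ite_and]

/-- The state of `V_ns` given by a pair of deterministic strategies. -/
noncomputable def detState (f g : Fin n → Fin k) : Vns n k →ₗ[ℂ] ℂ :=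
  (Jrel n k).liftQ (detW f g) (Jrel_le_ker_detW f g)

theorem detState_Qg (f g : Fin n → Fin k) (a b : Fin k) (x y : Fin n) :
    detState f g (Qg a b x y) = if f x = a ∧ g y = b then 1 else 0 :=
  detW_gen f g a b x y

theorem detState_ens [NeZero n] (f g : Fin n → Fin k) : detState f g (ens n k) = 1 := by
  simp [ens, detState_Qg, ite_and]

theorem detState_nonneg (f g : Fin n → Fin k) {v : Vns n k} (hv : v ∈ Dns n k) :
    0 ≤ detState f g v := by
  obtain ⟨t, ht, rfl⟩ := hv
  rw [map_sum]
  refine Finset.sum_nonneg fun i _ => ?_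
  rw [map_smul, detState_Qg, smul_eq_mul]
  refine mul_nonneg (Complex.zero_le_real.2 (ht i)) ?_
  split_ifs <;> simp

theorem mk_eq_sum (w : Wt n k) : (Submodule.Quotient.mk w : Vns n k) =
    ∑ x, ∑ y, ∑ a, ∑ b, w (a, b, x, y) • Qg a b x y := by
  have h : w = ∑ x, ∑ y, ∑ a, ∑ b, w (a, b, x, y) • gen a b x y := by
    funext ⟨a', b', x', y'⟩
    simp only [Finset.sum_apply, Pi.smul_apply, gen, Pi.single_apply, Prod.mk.injEq, smul_eq_mul,
      mul_ite, mul_one, mul_zero, ite_and]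
    simp
  conv_lhs => rw [h]
  simp only [Qg, ← Submodule.mkQ_apply, map_sum, map_smul]

/-- If all deterministic strategies vanish on `w`, then `w` splits as a function of one
outcome at a time. -/
theorem eq_of_detW_eq_zero [NeZero k] {w : Wt n k} (hw : ∀ f g, detW f g w = 0) (a b : Fin k)
    (x y : Fin n) :
    w (a, b, x, y) = w (a, 0, x, y) + (w (0, b, x, y) - w (0, 0, x, y)) := by
  have h : detW (Function.update 0 x a) (Function.update 0 y b) w - detW (Function.update 0 x a) 0 w
      - detW 0 (Function.update 0 y b) w + detW 0 0 w = 0 := by simp [hw]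
  simp only [detW_apply, ← Finset.sum_sub_distrib, ← Finset.sum_add_distrib] at h
  rw [Finset.sum_eq_single x, Finset.sum_eq_single y] at h
  · simp at h
    linear_combination h
  · intro y' _ hy; simp [hy]
  · simp
  · intro x' _ hx; simp [hx]
  · simp

theorem sum_left_eq_of_detW_eq_zero [NeZero k] {w : Wt n k} (hw : ∀ f g, detW f g w = 0)
    (a : Fin k) (x : Fin n) : ∑ y, w (a, 0, x, y) = ∑ y, w (0, 0, x, y) := by
  have h : detW (Function.update 0 x a) 0 w - detW 0 0 w = 0 := by simp [hw]
  simp only [detW_apply, ← Finset.sum_sub_distrib] at h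
  rw [Finset.sum_eq_single x] at h
  · simpa [sub_eq_zero] using h
  · intro x' _ hx; simp [hx]
  · simp

theorem sum_right_eq_of_detW_eq_zero [NeZero k] {w : Wt n k} (hw : ∀ f g, detW f g w = 0)
    (b : Fin k) (y : Fin n) : ∑ x, (w (0, b, x, y) - w (0, 0, x, y)) = 0 := by
  have h : detW 0 (Function.update 0 y b) w - detW 0 0 w = 0 := by simp [hw]
  simp only [detW_apply, ← Finset.sum_sub_distrib] at h
  rw [Finset.sum_comm, Finset.sum_eq_single y] at h
  · simpa using h
  · intro y' _ hy; simp [hy]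
  · simp

/-- Deterministic strategies separate the points of `V_ns`. -/
theorem eq_zero_of_detState_eq_zero [NeZero n] [NeZero k] {v : Vns n k}
    (hv : ∀ f g, detState f g v = 0) : v = 0 := by
  obtain ⟨w, rfl⟩ := Submodule.Quotient.mk_surjective _ v
  have hw : ∀ f g, detW f g w = 0 := hv
  have hleft : ∑ x, ∑ y, ∑ a, ∑ b, w (a, 0, x, y) • Qg a b x y = 0 := by
    have h1 : ∀ x : Fin n, ∑ y, ∑ a, ∑ b, w (a, 0, x, y) • Qg a b x y =
        (∑ y, w (0, 0, x, y)) • ens n k := by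
      intro x
      rw [Finset.sum_comm, ← sum_Qg_eq_ens x 0, Finset.smul_sum]
      refine Finset.sum_congr rfl fun a _ => ?_
      rw [← sum_left_eq_of_detW_eq_zero hw a x, Finset.sum_smul]
      refine Finset.sum_congr rfl fun y _ => ?_
      rw [← Finset.smul_sum, sum_Qg_left_eq a x y 0]
    have h2 := hw 0 0
    rw [detW_apply] at h2
    rw [Finset.sum_congr rfl fun x _ => h1 x, ← Finset.sum_smul]
    exact (congrArg (· • ens n k) h2).trans (zero_smul _ _)
  have hright : ∑ x, ∑ y, ∑ a, ∑ b, (w (0, b, x, y) - w (0, 0, x, y)) • Qg a b x y = 0 := by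
    rw [Finset.sum_comm]
    refine Finset.sum_eq_zero fun y _ => ?_
    have h1 : ∀ x : Fin n, ∑ a, ∑ b, (w (0, b, x, y) - w (0, 0, x, y)) • Qg a b x y =
        ∑ b, (w (0, b, x, y) - w (0, 0, x, y)) • ∑ a, Qg a b 0 y := by
      intro x
      rw [Finset.sum_comm]
      refine Finset.sum_congr rfl fun b _ => ?_
      rw [← Finset.smul_sum, sum_Qg_right_eq b y x 0]
    rw [Finset.sum_congr rfl fun x _ => h1 x, Finset.sum_comm]
    refine Finset.sum_eq_zero fun b _ => ?_
    rw [← Finset.sum_smul, sum_right_eq_of_detW_eq_zero hw b y, zero_smul]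
  rw [mk_eq_sum]
  refine Eq.trans ?_ ((congrArg₂ (· + ·) hleft hright).trans (add_zero 0))
  simp only [← Finset.sum_add_distrib, ← add_smul]
  refine Finset.sum_congr rfl fun x _ => Finset.sum_congr rfl fun y _ =>
    Finset.sum_congr rfl fun a _ => Finset.sum_congr rfl fun b _ => ?_
  rw [← eq_of_detW_eq_zero hw a b x y]

end NSpace

/-- `D_qc = C^max(p_1,…,p_N)^∞_1` is a proper cone, and the cones
`C^max(p_1,…,p_N)^∞_m` do not depend on the chosen enumeration of the generators. -/
theorem stmt_17 (n k : ℕ) [NeZero n] [NeZero k]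
    (N : ℕ) (hN : N = n ^ 2 * k ^ 2) (σ : Fin N ≃ Idx n k) :
    (∀ v : Vns n k,
      (Matrix.of fun _ _ => v : Matrix (Fin 1) (Fin 1) (Vns n k))
        ∈ coneInf (CmaxFam (Dns n k) (ens n k)) (ens n k) (genEnum σ) (Fin 1) →
      (Matrix.of fun _ _ => -v : Matrix (Fin 1) (Fin 1) (Vns n k))
        ∈ coneInf (CmaxFam (Dns n k) (ens n k)) (ens n k) (genEnum σ) (Fin 1) →
      v = 0) ∧
    (∀ (τ : Fin N ≃ Idx n k) (m : ℕ), 1 ≤ m →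
      coneInf (CmaxFam (Dns n k) (ens n k)) (ens n k) (genEnum σ) (Fin m) =
      coneInf (CmaxFam (Dns n k) (ens n k)) (ens n k) (genEnum τ) (Fin m)) := by
  have hC : ∀ v ∈ Dns n k, star v = v := fun v hv => star_of_mem_Dns hv
  have he : ens n k ∈ Dns n k := ens_mem_Dns
  have hp : ∀ (τ : Fin N ≃ Idx n k) i, genEnum τ i ∈ Dns n k := fun τ i => Qg_mem_Dns _ _ _ _
  have hp' : ∀ (τ : Fin N ≃ Idx n k) i, ens n k - genEnum τ i ∈ Dns n k :=
    fun τ i => ens_sub_Qg_mem_Dns _ _ _ _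
  have hN1 : 1 ≤ N := by
    rw [hN]
    exact Nat.one_le_iff_ne_zero.2 (mul_ne_zero (pow_ne_zero 2 (NeZero.ne n))
      (pow_ne_zero 2 (NeZero.ne k)))
  refine ⟨fun v hv hv' => eq_zero_of_detState_eq_zero fun f g => ?_, fun τ m _ => ?_⟩
  · have key := fun {u} => nonneg_of_mem_coneInf (v := u) he (hp σ) (hp' σ)
      (φ := detState f g) (fun w hw => detState_nonneg f g hw) (detState_ens f g)
      (fun i => by rw [genEnum, detState_Qg]; split_ifs <;> simp)
    have h := key hv'
    rw [map_neg, Left.nonneg_neg_iff] at h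
    exact le_antisymm h (key hv)
  · exact Set.Subset.antisymm
      (coneInf_subset hC he (hp σ) (hp' σ) (hp τ) (hp' τ) (ρ := fun i => τ.symm (σ i))
        (fun i => by simp [genEnum]) hN1)
      (coneInf_subset hC he (hp τ) (hp' τ) (hp σ) (hp' σ) (ρ := fun i => σ.symm (τ i))
        (fun i => by simp [genEnum]) hN1)
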